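/- arXiv:2505.04733 — 3 statements merged into one kernel-verified Lean document; each statement's English description precedes it below -/
import Mathlib

section
/- Let Y and R be independent real-valued random variables on a probability space (Ω, ℱ, P). Suppose the law of Y is absolutely continuous with respect to Lebesgue measure with density f, and suppose b ∈ ℝ satisfies: for every v > 0, f(b + v) ≤ f(b − v). Suppose further that R is symmetric, i.e., R and −R are identically distributed. Then P(Y + R ≤ b) ≤ P(Y ≤ b). (Adding an independent symmetric noise to a random variable whose density is peaked below b can only decrease the probability of lying below b; this is the upper-tail half of the smoothing step in the uncertain-imputation lemma.) -/
open MeasureTheory ProbabilityTheory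

/-- If a density is peaked below `b`, the mass just above `b` is at most the mass just below. -/
lemma withDensity_Ioc_le_reflected {g : ℝ → ENNReal} {b : ℝ}
    (hpeak : ∀ v > 0, g (b + v) ≤ g (b - v)) (r : ℝ) :
    volume.withDensity g (Set.Ioc b (b + r)) ≤ volume.withDensity g (Set.Ioc (b - r) b) := by
  rw [withDensity_apply _ measurableSet_Ioc, withDensity_apply _ measurableSet_Ioc,
    setLIntegral_congr (Ioo_ae_eq_Ioc (μ := volume)).symm,
    ← lintegral_indicator measurableSet_Ioo, ← lintegral_indicator measurableSet_Ioc,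
    ← lintegral_sub_left_eq_self _ (2 * b)]
  refine lintegral_mono fun y => Set.indicator_apply_le' (fun hy => ?_) fun _ => zero_le
  have hy' : y ∈ Set.Ioc (b - r) b := ⟨by linarith [hy.2], by linarith [hy.1]⟩
  rw [Set.indicator_of_mem hy']
  convert hpeak (b - y) (by linarith [hy.1]) using 2 <;> ring

/-- The distribution function of a law peaked below `b` is midpoint-concave at `b`. -/
lemma withDensity_Iic_add_le_two_mul {g : ℝ → ENNReal} {b : ℝ}
    (hpeak : ∀ v > 0, g (b + v) ≤ g (b - v)) (r : ℝ) :
    volume.withDensity g (Set.Iic (b - r)) + volume.withDensity g (Set.Iic (b + r)) ≤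
      2 * volume.withDensity g (Set.Iic b) := by
  wlog hr : 0 ≤ r generalizing r
  · have h := this (-r) (by linarith)
    rwa [sub_neg_eq_add, ← sub_eq_add_neg, add_comm] at h
  have split : ∀ {c d : ℝ}, c ≤ d → volume.withDensity g (Set.Iic d) =
      volume.withDensity g (Set.Iic c) + volume.withDensity g (Set.Ioc c d) := fun {c d} h => by
    rw [← Set.Iic_union_Ioc_eq_Iic h,
      measure_union (Set.Iic_disjoint_Ioc le_rfl) measurableSet_Ioc]
  calc _ = volume.withDensity g (Set.Iic b) + (volume.withDensity g (Set.Iic (b - r)) +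
        volume.withDensity g (Set.Ioc b (b + r))) := by
        rw [split (le_add_of_nonneg_right hr : b ≤ b + r)]; ring
    _ ≤ volume.withDensity g (Set.Iic b) + (volume.withDensity g (Set.Iic (b - r)) +
        volume.withDensity g (Set.Ioc (b - r) b)) := by
        gcongr _ + (_ + ?_)
        exact withDensity_Ioc_le_reflected hpeak r
    _ = _ := by rw [← split (sub_le_self b hr), two_mul]

/-- Adding independent symmetric noise to a random variable whose density is
peaked below b can only decrease the probability of lying below b. -/
theorem symmetric_noise_upper_tail {Ω : Type*} [MeasurableSpace Ω]
    (μ : Measure Ω) [IsProbabilityMeasure μ]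
    (Y R : Ω → ℝ) (hY : Measurable Y) (hR : Measurable R)
    (hindep : IndepFun Y R μ)
    (f : ℝ → ℝ) (hfm : Measurable f) (hf0 : ∀ x, 0 ≤ f x)
    (hdens : Measure.map Y μ = volume.withDensity (fun x => ENNReal.ofReal (f x)))
    (hsym : Measure.map R μ = Measure.map (fun ω => -R ω) μ)
    (b : ℝ) (hpeak : ∀ v > 0, f (b + v) ≤ f (b - v)) :
    μ {ω | Y ω + R ω ≤ b} ≤ μ {ω | Y ω ≤ b} := by
  have : IsProbabilityMeasure (μ.map Y) := Measure.isProbabilityMeasure_map hY.aemeasurable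
  have : IsProbabilityMeasure (μ.map R) := Measure.isProbabilityMeasure_map hR.aemeasurable
  have hcdf : Measurable fun x => μ.map Y (Set.Iic x) :=
    (show Monotone fun x => μ.map Y (Set.Iic x) from
      fun _ _ h => measure_mono (Set.Iic_subset_Iic.2 h)).measurable
  have hsub_meas : Measurable fun r => μ.map Y (Set.Iic (b - r)) := hcdf.comp (by fun_prop)
  have hsub : μ {ω | Y ω + R ω ≤ b} = ∫⁻ r, μ.map Y (Set.Iic (b - r)) ∂μ.map R := by
    have hs : MeasurableSet {p : ℝ × ℝ | p.1 + p.2 ≤ b} :=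
      measurableSet_le (by fun_prop) (by fun_prop)
    have h := Measure.map_apply (μ := μ) (hY.prodMk hR) hs
    rw [(indepFun_iff_map_prod_eq_prod_map_map hY.aemeasurable hR.aemeasurable).1 hindep,
      Measure.prod_apply_symm hs] at h
    refine h.symm.trans (lintegral_congr fun r => ?_)
    congr 1
    ext y
    simp [le_sub_iff_add_le]
  have hadd : μ {ω | Y ω + R ω ≤ b} = ∫⁻ r, μ.map Y (Set.Iic (b + r)) ∂μ.map R := by
    have hadd_meas : Measurable fun r => μ.map Y (Set.Iic (b + r)) := hcdf.comp (by fun_prop)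
    rw [hsub, lintegral_map hadd_meas hR]
    rw [hsym, lintegral_map hsub_meas (by fun_prop)]
    simp only [sub_neg_eq_add]
  have hYb : μ {ω | Y ω ≤ b} = μ.map Y (Set.Iic b) :=
    (Measure.map_apply hY measurableSet_Iic).symm
  have key : 2 * μ {ω | Y ω + R ω ≤ b} ≤ 2 * μ {ω | Y ω ≤ b} := by
    rw [two_mul]
    nth_rewrite 1 [hsub]
    rw [hadd, ← lintegral_add_left hsub_meas, hYb]
    calc _ ≤ ∫⁻ _, 2 * μ.map Y (Set.Iic b) ∂μ.map R := by
          refine lintegral_mono fun r => ?_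
          rw [hdens]
          exact withDensity_Iic_add_le_two_mul (g := fun x => ENNReal.ofReal (f x))
            (fun v hv => ENNReal.ofReal_le_ofReal (hpeak v hv)) r
      _ = _ := by simp
  exact (ENNReal.mul_le_mul_iff_right two_ne_zero ENNReal.ofNat_ne_top).1 key
end

section
/- Let Y and R be independent real-valued random variables on a probability space (Ω, ℱ, P). Suppose the law of Y is absolutely continuous with respect to Lebesgue measure with density f, and suppose a ∈ ℝ satisfies: for every v > 0, f(a − v) ≤ f(a + v). Suppose further that R is symmetric, i.e., R and −R are identically distributed. Then P(Y + R ≥ a) ≤ P(Y ≥ a). (Adding an independent symmetric noise to a random variable whose density is peaked above a can only decrease the probability of lying above a; this is the lower-tail half of the smoothing step in the uncertain-imputation lemma.) -/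
open MeasureTheory ProbabilityTheory

/-- If a density `g` is peaked above `a`, an interval just below `a` carries at most the mass of
its mirror image above `a`. -/
lemma withDensity_Ico_sub_le_Ico_add {g : ℝ → ENNReal} {a : ℝ}
    (hg : ∀ v > 0, g (a - v) ≤ g (a + v)) (r : ℝ) :
    volume.withDensity g (Set.Ico (a - r) a) ≤ volume.withDensity g (Set.Ico a (a + r)) := by
  rw [withDensity_apply _ measurableSet_Ico, withDensity_apply _ measurableSet_Ico,
    setLIntegral_congr (Ico_ae_eq_Ioc (a := a) (b := a + r)),
    ← lintegral_indicator measurableSet_Ico, ← lintegral_indicator measurableSet_Ioc,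
    ← lintegral_sub_left_eq_self _ (2 * a)]
  refine lintegral_mono fun x ↦ ?_
  by_cases hx : x ∈ Set.Ioc a (a + r)
  · have hx' : 2 * a - x ∈ Set.Ico (a - r) a := ⟨by linarith [hx.2], by linarith [hx.1]⟩
    have h := hg (x - a) (sub_pos.2 hx.1)
    rw [Set.indicator_of_mem hx, Set.indicator_of_mem hx']
    convert h using 2 <;> ring
  · have hx' : 2 * a - x ∉ Set.Ico (a - r) a := fun h ↦
      hx ⟨by linarith [h.2], by linarith [h.1]⟩
    rw [Set.indicator_of_notMem hx']
    exact zero_le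

/-- If a density `g` is peaked above `a`, the two half-lines starting at `a - r` and `a + r`
together carry at most twice the mass of the half-line starting at `a`. -/
lemma withDensity_Ici_sub_add_Ici_add_le {g : ℝ → ENNReal} {a : ℝ}
    (hg : ∀ v > 0, g (a - v) ≤ g (a + v)) (r : ℝ) :
    volume.withDensity g (Set.Ici (a - r)) + volume.withDensity g (Set.Ici (a + r)) ≤
      volume.withDensity g (Set.Ici a) + volume.withDensity g (Set.Ici a) := by
  wlog hr : 0 ≤ r generalizing r
  · have h := this (-r) (by linarith)
    rwa [sub_neg_eq_add, ← sub_eq_add_neg, add_comm] at h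
  set ν := volume.withDensity g
  have split {b c : ℝ} (hbc : b ≤ c) : ν (Set.Ici b) = ν (Set.Ico b c) + ν (Set.Ici c) := by
    rw [← Set.Ico_union_Ici_eq_Ici hbc,
      measure_union (Set.disjoint_left.2 fun x hx hx' ↦ hx.2.not_ge hx') measurableSet_Ici]
  calc ν (Set.Ici (a - r)) + ν (Set.Ici (a + r))
      = ν (Set.Ici a) + (ν (Set.Ico (a - r) a) + ν (Set.Ici (a + r))) := by
        rw [split (show a - r ≤ a by linarith)]; ring
    _ ≤ ν (Set.Ici a) + (ν (Set.Ico a (a + r)) + ν (Set.Ici (a + r))) := by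
        gcongr _ + (?_ + _)
        exact withDensity_Ico_sub_le_Ico_add hg r
    _ = ν (Set.Ici a) + ν (Set.Ici a) := by
        rw [← split (show a ≤ a + r by linarith)]

/-- The upper tail of a sum of independent variables, as an average of tails of the first. -/
lemma ProbabilityTheory.IndepFun.measure_le_add_eq_lintegral {Ω : Type*} [MeasurableSpace Ω]
    {μ : Measure Ω} [IsProbabilityMeasure μ] {Y R : Ω → ℝ} (h : IndepFun Y R μ)
    (hY : Measurable Y) (hR : Measurable R) (a : ℝ) :
    μ {ω | a ≤ Y ω + R ω} = ∫⁻ r, μ.map Y (Set.Ici (a - r)) ∂μ.map R := by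
  have := Measure.isProbabilityMeasure_map (μ := μ) hY.aemeasurable
  have := Measure.isProbabilityMeasure_map (μ := μ) hR.aemeasurable
  have hS : MeasurableSet {p : ℝ × ℝ | a ≤ p.1 + p.2} :=
    measurableSet_le measurable_const (measurable_fst.add measurable_snd)
  have key : μ {ω | a ≤ Y ω + R ω} = μ.map (fun ω ↦ (Y ω, R ω)) {p | a ≤ p.1 + p.2} :=
    (Measure.map_apply (hY.prodMk hR) hS).symm
  rw [key, (indepFun_iff_map_prod_eq_prod_map_map hY.aemeasurable hR.aemeasurable).1 h,
    Measure.prod_apply_symm hS]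
  refine lintegral_congr fun r ↦ congrArg _ ?_
  ext y
  simp

/-- Adding independent symmetric noise to a random variable whose density is
peaked above a can only decrease the probability of lying above a. -/
theorem symmetric_noise_lower_tail {Ω : Type*} [MeasurableSpace Ω]
    (μ : Measure Ω) [IsProbabilityMeasure μ]
    (Y R : Ω → ℝ) (hY : Measurable Y) (hR : Measurable R)
    (hindep : IndepFun Y R μ)
    (f : ℝ → ℝ) (hfm : Measurable f) (hf0 : ∀ x, 0 ≤ f x)
    (hdens : Measure.map Y μ = volume.withDensity (fun x => ENNReal.ofReal (f x)))
    (hsym : Measure.map R μ = Measure.map (fun ω => -R ω) μ)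
    (a : ℝ) (hpeak : ∀ v > 0, f (a - v) ≤ f (a + v)) :
    μ {ω | a ≤ Y ω + R ω} ≤ μ {ω | a ≤ Y ω} := by
  have := Measure.isProbabilityMeasure_map (μ := μ) hR.aemeasurable
  set G : ℝ → ENNReal := fun b ↦ μ.map Y (Set.Ici b) with hG_def
  have hG : Measurable G :=
    Antitone.measurable fun b c hbc ↦ measure_mono (Set.Ici_subset_Ici.2 hbc)
  have hGr : Measurable fun r ↦ G (a - r) := hG.comp (measurable_const.sub measurable_id)
  have hsum : μ {ω | a ≤ Y ω + R ω} = ∫⁻ r, G (a - r) ∂μ.map R :=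
    hindep.measure_le_add_eq_lintegral hY hR a
  have hrefl : ∫⁻ r, G (a - r) ∂μ.map R = ∫⁻ r, G (a + r) ∂μ.map R := by
    conv_lhs => rw [hsym]
    rw [lintegral_map hGr (show Measurable fun ω ↦ -R ω from hR.neg),
      lintegral_map (f := fun r ↦ G (a + r)) (hG.comp (measurable_const.add measurable_id)) hR]
    simp only [sub_neg_eq_add]
  have htail : μ {ω | a ≤ Y ω} = G a := (Measure.map_apply hY measurableSet_Ici).symm
  have hdouble : 2 * μ {ω | a ≤ Y ω + R ω} ≤ 2 * μ {ω | a ≤ Y ω} :=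
    calc 2 * μ {ω | a ≤ Y ω + R ω}
        = ∫⁻ r, G (a - r) + G (a + r) ∂μ.map R := by
          rw [lintegral_add_left hGr, ← hrefl, ← hsum, two_mul]
      _ ≤ ∫⁻ _, G a + G a ∂μ.map R := by
          refine lintegral_mono fun r ↦ ?_
          simp only [hG_def, hdens]
          exact withDensity_Ici_sub_add_Ici_add_le (g := fun x ↦ ENNReal.ofReal (f x))
            (fun v hv ↦ ENNReal.ofReal_le_ofReal (hpeak v hv)) r
      _ = 2 * μ {ω | a ≤ Y ω} := by
          rw [lintegral_const, measure_univ, mul_one, htail, two_mul]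
  exact (ENNReal.mul_le_mul_iff_right two_ne_zero ENNReal.ofNat_ne_top).1 hdouble
end

section
/- Let Y and R be independent real-valued random variables on a probability space (Ω, ℱ, P). Suppose the law of Y is absolutely continuous with respect to Lebesgue measure with density f, and let a ≤ b be reals such that: for every v > 0, f(b + v) ≤ f(b − v) and f(a − v) ≤ f(a + v). Suppose further that R is symmetric, i.e., R and −R are identically distributed. Then P(a ≤ Y + R ≤ b) ≤ P(a ≤ Y ≤ b). (This is the core conclusion of the uncertain-imputation lemma: the prediction interval [a, b] covers the symmetrically perturbed (imputed) response with probability no larger than it covers the true response, so calibrating conformal prediction on the imputed labels yields valid coverage of the true labels.) -/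
open MeasureTheory ProbabilityTheory

/-- Comparison of Lebesgue integrals through the reflection about `c`. -/
lemma lintegral_le_lintegral_of_reflection (u w : ℝ → ENNReal) (c : ℝ)
    (h : ∀ v, u (c + v) ≤ w (c - v)) : ∫⁻ x, u x ≤ ∫⁻ x, w x := by
  rw [← lintegral_add_left_eq_self u c, ← lintegral_sub_left_eq_self w c]
  exact lintegral_mono h

/-- If the density `g` at `c + v` is at most its value at `c - v` whenever `c + v ∈ s`, and `t`
contains the reflection of `s` about `c`, then `s` has at most the mass of `t`. -/
lemma withDensity_le_of_reflection (g : ℝ → ENNReal) (c : ℝ) {s t : Set ℝ}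
    (hs : MeasurableSet s) (ht : MeasurableSet t)
    (h : ∀ v, c + v ∈ s → c - v ∈ t ∧ g (c + v) ≤ g (c - v)) :
    volume.withDensity g s ≤ volume.withDensity g t := by
  rw [withDensity_apply _ hs, withDensity_apply _ ht, ← lintegral_indicator hs,
    ← lintegral_indicator ht]
  refine lintegral_le_lintegral_of_reflection _ _ c fun v => ?_
  by_cases hv : c + v ∈ s
  · simpa [hv, (h v hv).1] using (h v hv).2
  · simp [hv]

/-- Averaging the two translates of `[a, b]` by `r` and `-r` does not increase its mass. -/
lemma withDensity_Icc_add_Icc_le {f : ℝ → ℝ} {a b : ℝ} (hab : a ≤ b)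
    [IsFiniteMeasure (volume.withDensity fun x => ENNReal.ofReal (f x))]
    (hpeakb : ∀ v > 0, f (b + v) ≤ f (b - v))
    (hpeaka : ∀ v > 0, f (a - v) ≤ f (a + v)) {r : ℝ} (hr : 0 ≤ r) :
    (volume.withDensity fun x => ENNReal.ofReal (f x)) (Set.Icc (a - r) (b - r)) +
      (volume.withDensity fun x => ENNReal.ofReal (f x)) (Set.Icc (a + r) (b + r)) ≤
    2 * (volume.withDensity fun x => ENNReal.ofReal (f x)) (Set.Icc a b) := by
  have hb : (volume.withDensity fun x => ENNReal.ofReal (f x)) (Set.Ioc b (b + r)) ≤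
      (volume.withDensity fun x => ENNReal.ofReal (f x)) (Set.Ico (b - r) b) := by
    refine withDensity_le_of_reflection _ b measurableSet_Ioc measurableSet_Ico fun v hv => ?_
    obtain ⟨h₁, h₂⟩ := hv
    exact ⟨⟨by linarith, by linarith⟩, ENNReal.ofReal_le_ofReal (hpeakb v (by linarith))⟩
  have ha : (volume.withDensity fun x => ENNReal.ofReal (f x)) (Set.Ico (a - r) a) ≤
      (volume.withDensity fun x => ENNReal.ofReal (f x)) (Set.Ioc a (a + r)) := by
    refine withDensity_le_of_reflection _ a measurableSet_Ico measurableSet_Ioc fun v hv => ?_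
    obtain ⟨h₁, h₂⟩ := hv
    refine ⟨⟨by linarith, by linarith⟩, ENNReal.ofReal_le_ofReal ?_⟩
    simpa [sub_eq_add_neg] using hpeaka (-v) (by linarith)
  set ν := volume.withDensity fun x => ENNReal.ofReal (f x)
  have key : ∀ x y, x ≤ y →
      ν (Set.Ioc x y) = ENNReal.ofReal (ν.real (Set.Iic y) - ν.real (Set.Iic x))
      ∧ ν.real (Set.Iic x) ≤ ν.real (Set.Iic y) := by
    intro x y hxy
    refine ⟨?_, measureReal_mono (Set.Iic_subset_Iic.2 hxy)⟩
    rw [← measureReal_sdiff (Set.Iic_subset_Iic.2 hxy) measurableSet_Iic, Set.Iic_sdiff_Iic,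
      ofReal_measureReal]
  obtain ⟨e₁, l₁⟩ := key b (b + r) (by linarith)
  obtain ⟨e₂, l₂⟩ := key (b - r) b (by linarith)
  obtain ⟨e₃, l₃⟩ := key (a - r) a (by linarith)
  obtain ⟨e₄, l₄⟩ := key a (a + r) (by linarith)
  obtain ⟨e₅, l₅⟩ := key (a - r) (b - r) (by linarith)
  obtain ⟨e₆, l₆⟩ := key (a + r) (b + r) (by linarith)
  obtain ⟨e₇, l₇⟩ := key a b hab
  simp only [← Ioc_ae_eq_Icc.measure_eq (μ := ν), (Ico_ae_eq_Ioc (μ := ν)).measure_eq] at ha hb ⊢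
  rw [e₁, e₂, ENNReal.ofReal_le_ofReal_iff (by linarith)] at hb
  rw [e₃, e₄, ENNReal.ofReal_le_ofReal_iff (by linarith)] at ha
  rw [e₅, e₆, e₇, two_mul, ← ENNReal.ofReal_add (by linarith) (by linarith),
    ← ENNReal.ofReal_add (by linarith) (by linarith)]
  exact ENNReal.ofReal_le_ofReal (by linarith)

/-- Core of the uncertain-imputation lemma: if the density of Y is peaked inside
[a, b] and R is an independent symmetric noise, then [a, b] covers Y + R with
probability no larger than it covers Y. -/
theorem symmetric_noise_interval_coverage {Ω : Type*} [MeasurableSpace Ω]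
    (μ : Measure Ω) [IsProbabilityMeasure μ]
    (Y R : Ω → ℝ) (hY : Measurable Y) (hR : Measurable R)
    (hindep : IndepFun Y R μ)
    (f : ℝ → ℝ) (hfm : Measurable f) (hf0 : ∀ x, 0 ≤ f x)
    (hdens : Measure.map Y μ = volume.withDensity (fun x => ENNReal.ofReal (f x)))
    (hsym : Measure.map R μ = Measure.map (fun ω => -R ω) μ)
    (a b : ℝ) (hab : a ≤ b)
    (hpeakb : ∀ v > 0, f (b + v) ≤ f (b - v))
    (hpeaka : ∀ v > 0, f (a - v) ≤ f (a + v)) :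
    μ {ω | a ≤ Y ω + R ω ∧ Y ω + R ω ≤ b} ≤ μ {ω | a ≤ Y ω ∧ Y ω ≤ b} := by
  have : IsProbabilityMeasure (Measure.map Y μ) := Measure.isProbabilityMeasure_map hY.aemeasurable
  have : IsProbabilityMeasure (Measure.map R μ) := Measure.isProbabilityMeasure_map hR.aemeasurable
  set ρ := Measure.map R μ with hρ
  set ν := Measure.map Y μ with hν
  have hneg : ρ.map Neg.neg = ρ := by
    rw [hρ, Measure.map_map measurable_neg hR, ← hρ, hsym]
    rfl
  have hS : MeasurableSet {p : ℝ × ℝ | p.1 + p.2 ∈ Set.Icc a b} :=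
    measurableSet_Icc.preimage (measurable_fst.add measurable_snd)
  have hsection : ∀ r, (fun y : ℝ => (y, r)) ⁻¹' {p : ℝ × ℝ | p.1 + p.2 ∈ Set.Icc a b} =
      Set.Icc (a - r) (b - r) := by
    intro r
    ext y
    simp [le_sub_iff_add_le]
  have hmeas : Measurable fun r => ν (Set.Icc (a - r) (b - r)) := by
    simpa only [hsection] using measurable_measure_prodMk_right (μ := ν) hS
  have hsum : μ {ω | a ≤ Y ω + R ω ∧ Y ω + R ω ≤ b} = ∫⁻ r, ν (Set.Icc (a - r) (b - r)) ∂ρ := by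
    have hprod := (indepFun_iff_map_prod_eq_prod_map_map hY.aemeasurable hR.aemeasurable).1 hindep
    simp_rw [← hsection]
    rw [← Measure.prod_apply_symm hS, ← hprod, Measure.map_apply (hY.prodMk hR) hS]
    rfl
  have hreflect : ∫⁻ r, ν (Set.Icc (a - r) (b - r)) ∂ρ =
      ∫⁻ r, ν (Set.Icc (a + r) (b + r)) ∂ρ := by
    conv_lhs => rw [← hneg, lintegral_map hmeas measurable_neg]
    simp only [sub_neg_eq_add]
  have hbound : ∀ r, ν (Set.Icc (a - r) (b - r)) + ν (Set.Icc (a + r) (b + r)) ≤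
      2 * ν (Set.Icc a b) := by
    intro r
    have : IsFiniteMeasure (volume.withDensity fun x => ENNReal.ofReal (f x)) := by
      rw [← hdens]; infer_instance
    rw [hdens]
    rcases le_total 0 r with hr | hr
    · exact withDensity_Icc_add_Icc_le hab hpeakb hpeaka hr
    · rw [add_comm]
      simpa [sub_eq_add_neg] using
        withDensity_Icc_add_Icc_le hab hpeakb hpeaka (neg_nonneg.2 hr)
  have htarget : μ {ω | a ≤ Y ω ∧ Y ω ≤ b} = ν (Set.Icc a b) := by
    rw [hν, Measure.map_apply hY measurableSet_Icc]
    rfl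
  rw [hsum, htarget, ← ENNReal.mul_le_mul_iff_right two_ne_zero ENNReal.ofNat_ne_top]
  calc 2 * ∫⁻ r, ν (Set.Icc (a - r) (b - r)) ∂ρ
      = ∫⁻ r, (ν (Set.Icc (a - r) (b - r)) + ν (Set.Icc (a + r) (b + r))) ∂ρ := by
        rw [lintegral_add_left hmeas, ← hreflect, two_mul]
    _ ≤ ∫⁻ _, 2 * ν (Set.Icc a b) ∂ρ := lintegral_mono hbound
    _ = 2 * ν (Set.Icc a b) := by simp
end
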